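/- (Proposition 1: invariance of the rank-N kernel interpolation weights in the spectral scaling.) Let x ∈ X^N be such that Φ_N(x) is invertible, and let c = (c_1,…,c_N) ∈ ℝ^N. For a vector γ = (γ_1,…,γ_N) of positive reals, define the N×N matrix κ^γ(x) by κ^γ(x)_{ij} = Σ_{n=1}^N γ_n φ_n(x_i)φ_n(x_j) and the vector μ^γ(x) ∈ ℝ^N by μ^γ(x)_i = Σ_{n=1}^N γ_n c_n φ_n(x_i). Then κ^γ(x) is invertible and, for any two vectors γ, γ̃ of positive reals, κ^γ(x)⁻¹ · μ^γ(x) = κ^{γ̃}(x)⁻¹ · μ^{γ̃}(x). -/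

import Mathlib

open Matrix

/-- The matrix `Φ_N(x)` with entries `Φ_N(x)_{n,i} = φ_n(x_i)`. -/
def PhiMat {X : Type*} {N : ℕ} (φ : Fin N → X → ℝ) (x : Fin N → X) :
    Matrix (Fin N) (Fin N) ℝ :=
  Matrix.of fun n i => φ n (x i)

/-- The rank-`N` kernel matrix `κ^γ(x)_{ij} = Σ_n γ_n φ_n(x_i) φ_n(x_j)`. -/
def kernelMat {X : Type*} {N : ℕ} (φ : Fin N → X → ℝ) (γ : Fin N → ℝ)
    (x : Fin N → X) : Matrix (Fin N) (Fin N) ℝ :=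
  Matrix.of fun i j => ∑ n : Fin N, γ n * φ n (x i) * φ n (x j)

/-- The evaluation vector `μ^γ(x)_i = Σ_n γ_n c_n φ_n(x_i)` of the scaled embedding of
`g = Σ_n c_n φ_n`. -/
def muVec {X : Type*} {N : ℕ} (φ : Fin N → X → ℝ) (γ c : Fin N → ℝ)
    (x : Fin N → X) : Fin N → ℝ :=
  fun i => ∑ n : Fin N, γ n * c n * φ n (x i)

theorem kernelMat_factor {X : Type*} {N : ℕ} (φ : Fin N → X → ℝ) (γ : Fin N → ℝ)
    (x : Fin N → X) :
    kernelMat φ γ x = (PhiMat φ x)ᵀ * (Matrix.diagonal γ * PhiMat φ x) := by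
  ext i j
  rw [Matrix.mul_apply]
  simp only [kernelMat, PhiMat, Matrix.of_apply, Matrix.transpose_apply, Matrix.diagonal_mul]
  exact Finset.sum_congr rfl fun n _ => by ring

theorem muVec_factor {X : Type*} {N : ℕ} (φ : Fin N → X → ℝ) (γ c : Fin N → ℝ)
    (x : Fin N → X) :
    muVec φ γ c x = (PhiMat φ x)ᵀ *ᵥ (Matrix.diagonal γ *ᵥ c) := by
  ext i
  simp only [muVec, PhiMat, Matrix.mulVec, dotProduct, Matrix.transpose_apply, Matrix.of_apply]
  refine Finset.sum_congr rfl fun n _ => ?_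
  have : ∑ j, Matrix.diagonal γ n j * c j = γ n * c n := Matrix.mulVec_diagonal γ c n
  rw [this]; ring

theorem kernelMat_isUnit {X : Type*} {N : ℕ} (φ : Fin N → X → ℝ) (γ : Fin N → ℝ)
    (x : Fin N → X) (hx : IsUnit (PhiMat φ x).det) (hγ : ∀ n, 0 < γ n) :
    IsUnit (kernelMat φ γ x).det := by
  rw [kernelMat_factor, Matrix.det_mul, Matrix.det_mul, Matrix.det_transpose, Matrix.det_diagonal]
  exact hx.mul ((isUnit_iff_ne_zero.2 (Finset.prod_ne_zero_iff.2 fun n _ => (hγ n).ne')).mul hx)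

theorem kernel_weights_eq {X : Type*} {N : ℕ} (φ : Fin N → X → ℝ) (γ c : Fin N → ℝ)
    (x : Fin N → X) (hx : IsUnit (PhiMat φ x).det) (hγ : ∀ n, 0 < γ n) :
    (kernelMat φ γ x)⁻¹ *ᵥ muVec φ γ c x = (PhiMat φ x)⁻¹ *ᵥ c := by
  have h : muVec φ γ c x = kernelMat φ γ x *ᵥ ((PhiMat φ x)⁻¹ *ᵥ c) := by
    rw [muVec_factor, kernelMat_factor, Matrix.mulVec_mulVec, Matrix.mulVec_mulVec,
      Matrix.mul_assoc, Matrix.mul_assoc, Matrix.mul_nonsing_inv _ hx, Matrix.mul_one]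
  rw [h, Matrix.mulVec_mulVec, Matrix.nonsing_inv_mul _ (kernelMat_isUnit φ γ x hx hγ),
    Matrix.one_mulVec]

/-- Proposition 1: invariance of the rank-`N` kernel interpolation
weights in the spectral scaling `γ`. -/
theorem kernel_interpolation_weights_invariant
    {X : Type*} (N : ℕ) (hN : 0 < N) (φ : Fin N → X → ℝ)
    (x : Fin N → X) (hx : IsUnit (PhiMat φ x).det)
    (c : Fin N → ℝ) (γ γ' : Fin N → ℝ)
    (hγ : ∀ n, 0 < γ n) (hγ' : ∀ n, 0 < γ' n) :
    IsUnit (kernelMat φ γ x).det ∧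
    (kernelMat φ γ x)⁻¹ *ᵥ muVec φ γ c x
      = (kernelMat φ γ' x)⁻¹ *ᵥ muVec φ γ' c x := by
  exact ⟨kernelMat_isUnit φ γ x hx hγ,
    (kernel_weights_eq φ γ c x hx hγ).trans (kernel_weights_eq φ γ' c x hx hγ').symm⟩
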